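/- Let G be a non-compact group equipped with a T0 Alexandroff topology making G a paratopological group (multiplication continuous). Then G is a directed set under the specialization order (for all x, y ∈ G there exists z ∈ G with x ≤ z and y ≤ z, i.e., z ∈ closure {x} ∩ closure {y}) if and only if G is hyperconnected (every pair of nonempty open subsets of G intersects). -/

import Mathlib

/-- In a paratopological group, inversion reverses specialization. -/
theorem Specializes.inv_of_continuousMul {G : Type*} [Group G] [TopologicalSpace G]
    [ContinuousMul G] {x y : G} (h : x ⤳ y) : y⁻¹ ⤳ x⁻¹ := by
  simpa using ((specializes_refl x⁻¹).mul h).mul (specializes_refl y⁻¹)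

/-- A non-compact Alexandroff paratopological group is directed under the specialization order
(any two elements have a common upper bound) if and only if it is hyperconnected (any two
nonempty open sets intersect). -/
theorem directed_iff_hyperconnected
    (G : Type*) [Group G] [TopologicalSpace G] [AlexandrovDiscrete G] [T0Space G]
    [ContinuousMul G] [NoncompactSpace G] :
    (∀ x y : G, ∃ z : G, z ∈ closure ({x} : Set G) ∩ closure ({y} : Set G)) ↔
      (∀ U V : Set G, IsOpen U → IsOpen V → U.Nonempty → V.Nonempty →
        (U ∩ V).Nonempty) := by
  simp only [Set.mem_inter_iff, ← specializes_iff_mem_closure]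
  constructor
  · rintro h U V hU hV ⟨u, hu⟩ ⟨v, hv⟩
    obtain ⟨z, huz, hvz⟩ := h u⁻¹ v⁻¹
    refine ⟨z⁻¹, ?_, ?_⟩
    · exact (inv_inv u ▸ huz.inv_of_continuousMul).mem_open hU hu
    · exact (inv_inv v ▸ hvz.inv_of_continuousMul).mem_open hV hv
  · intro h x y
    obtain ⟨z, hzx, hzy⟩ := h (nhdsKer {x⁻¹}) (nhdsKer {y⁻¹}) isOpen_nhdsKer isOpen_nhdsKer
      ⟨x⁻¹, subset_nhdsKer rfl⟩ ⟨y⁻¹, subset_nhdsKer rfl⟩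
    rw [mem_nhdsKer_singleton] at hzx hzy
    exact ⟨z⁻¹, inv_inv x ▸ hzx.inv_of_continuousMul, inv_inv y ▸ hzy.inv_of_continuousMul⟩
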